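/- arXiv:2211.04412 — 5 statements merged into one kernel-verified Lean document; each statement's English description precedes it below -/
import Mathlib

section
/- For every pair of points p, q ∈ ℝ³ there exists a continuous curve γ : [0,1] → ℝ³ with γ(0) = p and γ(1) = q whose Korányi length L_K(γ) equals the infimum of L_K(γ̃) over all continuous curves γ̃ : [0,1] → ℝ³ with γ̃(0) = p and γ̃(1) = q; that is, a shortest curve (geodesic) for the Korányi length exists. -/
open Set Filter

/-- A partition `a = t 0 < t 1 < ⋯ < t n = b` of the interval `[a,b]`. -/
def IsPartition (a b : ℝ) (n : ℕ) (t : ℕ → ℝ) : Prop :=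
  t 0 = a ∧ t n = b ∧ ∀ i < n, t i < t (i + 1)

/-- The length of a curve `γ : [a,b] → X` in a metric space, as the supremum over
all partitions of the sums of distances of consecutive partition points. -/
noncomputable def curveLength {X : Type*} [MetricSpace X] (γ : ℝ → X) (a b : ℝ) : ENNReal :=
  ⨆ (n : ℕ) (t : ℕ → ℝ) (_ : IsPartition a b n t),
    ENNReal.ofReal (∑ i ∈ Finset.range n, dist (γ (t (i + 1))) (γ (t i)))

/-- The Korányi distance on `ℝ³`. -/
noncomputable def dK (p q : EuclideanSpace ℝ (Fin 3)) : ℝ :=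
  ((|p 0 - q 0| ^ 2 + |p 1 - q 1| ^ 2) ^ 2
    + |p 2 - q 2 + 2 * (p 1 * q 0 - p 0 * q 1)| ^ 2) ^ ((1 : ℝ) / 4)

/-- The Korányi length of a curve `γ : [a,b] → ℝ³`. -/
noncomputable def korLength (γ : ℝ → EuclideanSpace ℝ (Fin 3)) (a b : ℝ) : ENNReal :=
  ⨆ (n : ℕ) (t : ℕ → ℝ) (_ : IsPartition a b n t),
    ENNReal.ofReal (∑ i ∈ Finset.range n, dK (γ (t (i + 1))) (γ (t i)))

/-- The point `(x,y,z) ∈ ℝ³`. -/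
noncomputable def mk3 (x y z : ℝ) : EuclideanSpace ℝ (Fin 3) :=
  (WithLp.equiv 2 (Fin 3 → ℝ)).symm ![x, y, z]

open scoped NNReal ENNReal Topology

section MetricCurves

variable {X : Type*}

theorem BoundedVariationOn.continuousOn_variationOnFromTo [PseudoEMetricSpace X] {f : ℝ → X}
    {s : Set ℝ} (hf : BoundedVariationOn f s) (hc : ContinuousOn f s) {a : ℝ} (ha : a ∈ s) :
    ContinuousOn (variationOnFromTo f s a) s := by
  intro x hx
  have hsmall : Tendsto (fun y ↦ variationOnFromTo f s x y) (𝓝[s] x) (𝓝 0) := by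
    have hl := (ENNReal.tendsto_toReal ENNReal.zero_ne_top).comp
      (hf.tendsto_eVariationOn_Icc_zero_left ((hc x hx).mono inter_subset_left))
    have hr := (ENNReal.tendsto_toReal ENNReal.zero_ne_top).comp
      (hf.tendsto_eVariationOn_Icc_zero_right x ((hc x hx).mono inter_subset_left))
    have hsum := hl.add hr
    simp only [ENNReal.toReal_zero, add_zero] at hsum
    refine squeeze_zero_norm (fun y ↦ ?_) hsum
    rcases le_total x y with h | h
    · rw [variationOnFromTo.eq_of_le _ _ h, Real.norm_of_nonneg ENNReal.toReal_nonneg]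
      exact le_add_of_nonneg_left ENNReal.toReal_nonneg
    · rw [variationOnFromTo.eq_of_ge _ _ h, norm_neg, Real.norm_of_nonneg ENNReal.toReal_nonneg]
      exact le_add_of_nonneg_right ENNReal.toReal_nonneg
  have hadd := hsmall.const_add (variationOnFromTo f s a x)
  rw [add_zero] at hadd
  refine hadd.congr' ?_
  filter_upwards [self_mem_nhdsWithin] with y hy
  exact variationOnFromTo.add hf.locallyBoundedVariationOn ha hx hy

/-- A continuous rectifiable curve has a reparametrization that is Lipschitz with constant its
length. -/
theorem exists_lipschitz_reparametrization [MetricSpace X] {f : ℝ → X}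
    (hc : ContinuousOn f (Icc 0 1)) (hf : BoundedVariationOn f (Icc 0 1)) :
    ∃ g : ℝ → X, g 0 = f 0 ∧ g 1 = f 1 ∧
      LipschitzOnWith (eVariationOn f (Icc 0 1)).toNNReal g (Icc 0 1) ∧
      eVariationOn g (Icc 0 1) ≤ eVariationOn f (Icc 0 1) := by
  have h0 : (0 : ℝ) ∈ Icc (0 : ℝ) 1 := by simp
  have h1 : (1 : ℝ) ∈ Icc (0 : ℝ) 1 := by simp
  have hloc := hf.locallyBoundedVariationOn
  set V := variationOnFromTo f (Icc 0 1) 0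
  set L := eVariationOn f (Icc 0 1) with hL
  have hV0 : V 0 = 0 := variationOnFromTo.self f _ 0
  have hV1 : V 1 = L.toReal := by
    simp [V, variationOnFromTo.eq_of_le f (Icc 0 1) zero_le_one, hL]
  have hVc : ContinuousOn V (Icc 0 1) := hf.continuousOn_variationOnFromTo hc h0
  have himage : Icc 0 L.toReal ⊆ V '' Icc 0 1 := by
    have := intermediate_value_Icc zero_le_one hVc
    rwa [hV0, hV1] at this
  set N := naturalParameterization f (Icc 0 1) 0
  have hN := has_unit_speed_naturalParameterization f hloc h0
  have hmaps : MapsTo (fun u : ℝ ↦ L.toReal * u) (Icc 0 1) (Icc 0 L.toReal) := fun u hu ↦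
    ⟨mul_nonneg ENNReal.toReal_nonneg hu.1, mul_le_of_le_one_right ENNReal.toReal_nonneg hu.2⟩
  refine ⟨N ∘ fun u ↦ L.toReal * u, ?_, ?_, ?_, ?_⟩
  · have := edist_naturalParameterization_eq_zero hloc h0 h0
    simpa [hV0, V, N] using edist_eq_zero.1 this
  · have := edist_naturalParameterization_eq_zero hloc h0 h1
    simpa [V, N, ← hV1] using edist_eq_zero.1 this
  · have key : ∀ x ∈ Icc (0 : ℝ) 1, ∀ y ∈ Icc (0 : ℝ) 1, x ≤ y →
        edist (N (L.toReal * x)) (N (L.toReal * y)) ≤ L.toNNReal * edist x y := by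
      intro x hx y hy hxy
      have hle : L.toReal * x ≤ L.toReal * y :=
        mul_le_mul_of_nonneg_left hxy ENNReal.toReal_nonneg
      have hxV := himage (hmaps hx)
      have hyV := himage (hmaps hy)
      calc edist (N (L.toReal * x)) (N (L.toReal * y))
          ≤ eVariationOn N (V '' Icc 0 1 ∩ Icc (L.toReal * x) (L.toReal * y)) :=
            eVariationOn.edist_le N ⟨hxV, le_rfl, hle⟩ ⟨hyV, hle, le_rfl⟩
        _ = ENNReal.ofReal (L.toReal * (y - x)) := by
            rw [hN hxV hyV]; congr 1; push_cast; ring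
        _ = L.toNNReal * edist x y := by
            rw [ENNReal.ofReal_mul ENNReal.toReal_nonneg, edist_comm, edist_dist, Real.dist_eq,
              abs_of_nonneg (sub_nonneg.2 hxy), ENNReal.ofReal_toReal hf,
              ENNReal.coe_toNNReal hf]
    intro x hx y hy
    rcases le_total x y with h | h
    · exact key x hx y hy h
    · rw [edist_comm, edist_comm x]
      exact key y hy x hx h
  · calc eVariationOn (N ∘ fun u ↦ L.toReal * u) (Icc 0 1)
        ≤ eVariationOn N (V '' Icc 0 1 ∩ Icc 0 L.toReal) :=
          eVariationOn.comp_le_of_monotoneOn _ _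
            (fun x _ y _ h ↦ mul_le_mul_of_nonneg_left h ENNReal.toReal_nonneg)
            fun u hu ↦ ⟨himage (hmaps hu), hmaps hu⟩
      _ = L := by
          rw [hN (himage ⟨le_rfl, ENNReal.toReal_nonneg⟩)
            (himage ⟨ENNReal.toReal_nonneg, le_rfl⟩)]
          simp [ENNReal.ofReal_toReal (show L ≠ ⊤ from hf)]

/-- In a proper metric space, two points that are joined by a continuous curve are joined by a
continuous curve of least length. -/
theorem exists_continuousOn_eVariationOn_minimal [MetricSpace X] [ProperSpace X] {p q : X}
    (hpq : ∃ f : ℝ → X, ContinuousOn f (Icc 0 1) ∧ f 0 = p ∧ f 1 = q) :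
    ∃ f : ℝ → X, (ContinuousOn f (Icc 0 1) ∧ f 0 = p ∧ f 1 = q) ∧
      ∀ g : ℝ → X, ContinuousOn g (Icc 0 1) ∧ g 0 = p ∧ g 1 = q →
        eVariationOn f (Icc 0 1) ≤ eVariationOn g (Icc 0 1) := by
  set ℓ : ℝ≥0∞ := ⨅ (g : ℝ → X) (_ : ContinuousOn g (Icc 0 1) ∧ g 0 = p ∧ g 1 = q),
    eVariationOn g (Icc 0 1) with hℓ
  have hℓ_le : ∀ g : ℝ → X, ContinuousOn g (Icc 0 1) ∧ g 0 = p ∧ g 1 = q →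
      ℓ ≤ eVariationOn g (Icc 0 1) := fun g hg ↦ iInf₂_le g hg
  rcases eq_or_ne ℓ ⊤ with htop | htop
  · obtain ⟨f, hf⟩ := hpq
    refine ⟨f, hf, fun g hg ↦ ?_⟩
    exact le_top.trans (htop.ge.trans (hℓ_le g hg))
  have hseq : ∀ n : ℕ, ∃ g : ℝ → X, g 0 = p ∧ g 1 = q ∧
      LipschitzOnWith (ℓ + 1).toNNReal g (Icc 0 1) ∧
      eVariationOn g (Icc 0 1) ≤ ℓ + ((n : ℝ≥0∞) + 1)⁻¹ := by
    intro n
    have hlt : ℓ < ℓ + ((n : ℝ≥0∞) + 1)⁻¹ :=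
      ENNReal.lt_add_right htop (by simp)
    conv_lhs at hlt => rw [hℓ]
    simp only [iInf_lt_iff] at hlt
    obtain ⟨f, ⟨hfc, hf0, hf1⟩, hfl⟩ := hlt
    obtain ⟨g, hg0, hg1, hgL, hgl⟩ := exists_lipschitz_reparametrization hfc hfl.ne_top
    refine ⟨g, hg0.trans hf0, hg1.trans hf1, hgL.weaken ?_, hgl.trans hfl.le⟩
    refine ENNReal.toNNReal_mono (by simp [htop]) (hfl.le.trans ?_)
    gcongr
    simp
  choose σ hσ0 hσ1 hσL hσl using hseq
  set C := (ℓ + 1).toNNReal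
  have hlim : ∀ u : ℝ, ∃ x : X, u ∈ Icc (0 : ℝ) 1 →
      Tendsto (fun n ↦ σ n u) (hyperfilter ℕ) (𝓝 x) := by
    intro u
    by_cases hu : u ∈ Icc (0 : ℝ) 1
    · have hmem : ∀ n, σ n u ∈ Metric.closedBall p C := fun n ↦ by
        have := (hσL n).dist_le_mul u hu 0 (by simp)
        rw [hσ0, Real.dist_eq, sub_zero, abs_of_nonneg hu.1] at this
        exact this.trans (mul_le_of_le_one_right C.2 hu.2)
      obtain ⟨x, -, hx⟩ := (isCompact_closedBall p (C : ℝ)).ultrafilter_le_nhds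
        ((hyperfilter ℕ).map fun n ↦ σ n u)
        (le_principal_iff.2 (mem_map.2 (univ_mem' hmem)))
      exact ⟨x, fun _ ↦ hx⟩
    · exact ⟨p, fun h ↦ absurd h hu⟩
  choose f hf using hlim
  have hfL : LipschitzOnWith C f (Icc 0 1) := LipschitzOnWith.of_dist_le_mul fun x hx y hy ↦
    le_of_tendsto ((hf x hx).dist (hf y hy))
      (Eventually.of_forall fun n ↦ (hσL n).dist_le_mul x hx y hy)
  have hend : ∀ u ∈ Icc (0 : ℝ) 1, ∀ x, (∀ n, σ n u = x) → f u = x := fun u hu x hx ↦ by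
    have := hf u hu
    simp only [hx] at this
    exact tendsto_nhds_unique this tendsto_const_nhds
  refine ⟨f, ⟨hfL.continuousOn, hend 0 (by simp) p hσ0, hend 1 (by simp) q hσ1⟩,
    fun g hg ↦ le_trans (le_of_forall_lt_imp_le_of_dense fun v hv ↦ ?_) (hℓ_le g hg)⟩
  have htend : Tendsto (fun n : ℕ ↦ ℓ + ((n : ℝ≥0∞) + 1)⁻¹) (hyperfilter ℕ) (𝓝 ℓ) := by
    have h : Tendsto (fun n : ℕ ↦ ((n : ℝ≥0∞) + 1)⁻¹) atTop (𝓝 0) := by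
      have := (tendsto_add_atTop_iff_nat 1).2 ENNReal.tendsto_inv_nat_nhds_zero
      simpa using this
    simpa using (h.const_add ℓ).mono_left Nat.hyperfilter_le_atTop
  refine ge_of_tendsto htend ?_
  filter_upwards [eVariationOn.lowerSemicontinuous_aux hf hv] with n hn
  exact hn.le.trans (hσl n)

end MetricCurves

section Partitions

variable {X : Type*} [PseudoMetricSpace X]

theorem IsPartition.strictMonoOn {a b : ℝ} {n : ℕ} {t : ℕ → ℝ} (ht : IsPartition a b n t) :
    StrictMonoOn t (Iic n) :=
  strictMonoOn_Iic_of_lt_succ ht.2.2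

theorem IsPartition.mem_Icc {a b : ℝ} {n : ℕ} {t : ℕ → ℝ} (ht : IsPartition a b n t) {i : ℕ}
    (hi : i ≤ n) : t i ∈ Icc a b := by
  refine ⟨?_, ?_⟩
  · rw [← ht.1]
    exact ht.strictMonoOn.monotoneOn (Nat.zero_le n) hi (Nat.zero_le i)
  · rw [← ht.2.1]
    exact ht.strictMonoOn.monotoneOn hi (mem_Iic.2 le_rfl) hi

/-- A strictly increasing finite sequence in `[a,b]` can be completed to a partition of `[a,b]`
without decreasing sums of nonnegative terms over consecutive points. -/
theorem exists_isPartition_sum_le {a b : ℝ} (F : ℝ → ℝ → ℝ≥0∞) {n : ℕ} {u : ℕ → ℝ}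
    (hu : ∀ i < n, u i < u (i + 1)) (ha : a ≤ u 0) (hb : u n ≤ b) :
    ∃ m t, IsPartition a b m t ∧
      ∑ i ∈ Finset.range n, F (u (i + 1)) (u i) ≤ ∑ i ∈ Finset.range m, F (t (i + 1)) (t i) := by
  have hleft : ∃ (m : ℕ) (t : ℕ → ℝ), t 0 = a ∧ t m = u n ∧ (∀ i < m, t i < t (i + 1)) ∧
      ∑ i ∈ Finset.range n, F (u (i + 1)) (u i) ≤
        ∑ i ∈ Finset.range m, F (t (i + 1)) (t i) := by
    rcases ha.eq_or_lt with h | h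
    · exact ⟨n, u, h.symm, rfl, hu, le_rfl⟩
    · refine ⟨n + 1, fun i ↦ Nat.casesOn i a u, rfl, rfl, ?_, ?_⟩
      · rintro (_ | i) hi
        · exact h
        · exact hu i (by omega)
      · rw [Finset.sum_range_succ']
        exact le_self_add
  obtain ⟨m, t, ht0, htm, ht, hsum⟩ := hleft
  rcases hb.eq_or_lt with h | h
  · exact ⟨m, t, ⟨ht0, htm.trans h, ht⟩, hsum⟩
  · refine ⟨m + 1, fun i ↦ if i ≤ m then t i else b, ⟨by simpa using ht0, by simp, ?_⟩,
      hsum.trans ?_⟩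
    · intro i hi
      rcases (Nat.lt_succ_iff.1 hi).eq_or_lt with rfl | hi'
      · simpa [htm] using h
      · simpa [hi'.le, Nat.succ_le_of_lt hi'] using ht i hi'
    · rw [Finset.sum_range_succ]
      refine le_trans (Finset.sum_le_sum fun i hi ↦ ?_) le_self_add
      have hi' := Finset.mem_range.1 hi
      simp [hi'.le, Nat.succ_le_of_lt hi']

theorem iSup_isPartition_eq_eVariationOn (f : ℝ → X) (a b : ℝ) :
    ⨆ (n : ℕ) (t : ℕ → ℝ) (_ : IsPartition a b n t),
      ENNReal.ofReal (∑ i ∈ Finset.range n, dist (f (t (i + 1))) (f (t i))) =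
    eVariationOn f (Icc a b) := by
  have hsum : ∀ (n : ℕ) (t : ℕ → ℝ),
      ENNReal.ofReal (∑ i ∈ Finset.range n, dist (f (t (i + 1))) (f (t i))) =
        ∑ i ∈ Finset.range n, edist (f (t (i + 1))) (f (t i)) := fun n t ↦ by
    rw [ENNReal.ofReal_sum_of_nonneg fun _ _ ↦ dist_nonneg]
    simp only [edist_dist]
  simp only [hsum]
  refine le_antisymm (iSup_le fun n ↦ iSup₂_le fun t ht ↦ ?_) ?_
  · exact eVariationOn.sum_le_of_monotoneOn_Iic ht.strictMonoOn.monotoneOn fun i hi ↦ ht.mem_Icc hi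
  · rw [eVariationOn.eVariationOn_eq_strictMonoOn]
    refine iSup_le fun ⟨n, u, hu, hmem⟩ ↦ ?_
    obtain ⟨m, t, ht, hle⟩ := exists_isPartition_sum_le (fun x y ↦ edist (f x) (f y))
      (fun i hi ↦ hu (show i ≤ n from hi.le) (show i + 1 ≤ n from hi) i.lt_succ_self)
      (hmem 0 (Nat.zero_le n)).1 (hmem n (mem_Iic.2 le_rfl)).2
    exact hle.trans (le_iSup_of_le m (le_iSup₂_of_le t ht le_rfl))

end Partitions

section Koranyi

/-- The horizontal part of `q⁻¹ * p` in the Heisenberg group, as a complex number. -/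
noncomputable def horizontalPart (p q : EuclideanSpace ℝ (Fin 3)) : ℂ := ⟨p 0 - q 0, p 1 - q 1⟩

/-- The vertical part of `q⁻¹ * p` in the Heisenberg group. -/
noncomputable def verticalPart (p q : EuclideanSpace ℝ (Fin 3)) : ℝ :=
  p 2 - q 2 + 2 * (p 1 * q 0 - p 0 * q 1)

/-- The complex number `|z|² + i t`, where `(z, t) = q⁻¹ * p`, whose norm is `dK p q ^ 2`. -/
noncomputable def koranyiGauge (p q : EuclideanSpace ℝ (Fin 3)) : ℂ :=
  ⟨Complex.normSq (horizontalPart p q), verticalPart p q⟩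

theorem dK_eq_sqrt_norm (p q : EuclideanSpace ℝ (Fin 3)) : dK p q = √‖koranyiGauge p q‖ := by
  rw [Complex.norm_def, Real.sqrt_eq_rpow, Real.sqrt_eq_rpow,
    ← Real.rpow_mul (Complex.normSq_nonneg _)]
  unfold dK
  simp only [sq_abs, koranyiGauge, horizontalPart, verticalPart, Complex.normSq_mk]
  congr 1 <;> ring

theorem dK_nonneg (p q : EuclideanSpace ℝ (Fin 3)) : 0 ≤ dK p q := by
  rw [dK_eq_sqrt_norm]; positivity

theorem sq_dK (p q : EuclideanSpace ℝ (Fin 3)) : dK p q ^ 2 = ‖koranyiGauge p q‖ := by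
  rw [dK_eq_sqrt_norm, Real.sq_sqrt (norm_nonneg _)]

theorem norm_horizontalPart_le_dK (p q : EuclideanSpace ℝ (Fin 3)) :
    ‖horizontalPart p q‖ ≤ dK p q := by
  refine le_of_sq_le_sq ?_ (dK_nonneg p q)
  rw [sq_dK, Complex.sq_norm]
  exact Complex.re_le_norm (koranyiGauge p q)

theorem abs_verticalPart_le_sq_dK (p q : EuclideanSpace ℝ (Fin 3)) :
    |verticalPart p q| ≤ dK p q ^ 2 := by
  rw [sq_dK]
  exact Complex.abs_im_le_norm (koranyiGauge p q)

theorem dK_self (p : EuclideanSpace ℝ (Fin 3)) : dK p p = 0 := by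
  have : koranyiGauge p p = 0 := by
    apply Complex.ext <;>
      simp [koranyiGauge, horizontalPart, verticalPart, Complex.normSq_mk, mul_comm]
  simp [dK_eq_sqrt_norm, this]

theorem dK_comm (p q : EuclideanSpace ℝ (Fin 3)) : dK p q = dK q p := by
  have : koranyiGauge p q = (starRingEnd ℂ) (koranyiGauge q p) := by
    apply Complex.ext <;>
      simp [koranyiGauge, horizontalPart, verticalPart, Complex.normSq_mk] <;> ring
  rw [dK_eq_sqrt_norm, dK_eq_sqrt_norm, this, Complex.norm_conj]

theorem dK_triangle (p q r : EuclideanSpace ℝ (Fin 3)) : dK p r ≤ dK p q + dK q r := by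
  refine le_of_sq_le_sq ?_ (add_nonneg (dK_nonneg p q) (dK_nonneg q r))
  have hsum : koranyiGauge p r = koranyiGauge p q + koranyiGauge q r +
      2 * ((starRingEnd ℂ) (horizontalPart p q) * horizontalPart q r) := by
    apply Complex.ext <;>
      simp [koranyiGauge, horizontalPart, verticalPart, Complex.normSq_mk] <;> ring
  calc dK p r ^ 2 = ‖koranyiGauge p r‖ := sq_dK p r
    _ ≤ ‖koranyiGauge p q‖ + ‖koranyiGauge q r‖ +
        2 * (‖horizontalPart p q‖ * ‖horizontalPart q r‖) := by
      rw [hsum]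
      refine (norm_add₃_le).trans_eq ?_
      simp
    _ ≤ dK p q ^ 2 + dK q r ^ 2 + 2 * (dK p q * dK q r) := by
      rw [← sq_dK, ← sq_dK]
      have := mul_le_mul (norm_horizontalPart_le_dK p q) (norm_horizontalPart_le_dK q r)
        (norm_nonneg _) (dK_nonneg p q)
      linarith
    _ = (dK p q + dK q r) ^ 2 := by ring

theorem eq_of_dK_eq_zero {p q : EuclideanSpace ℝ (Fin 3)} (h : dK p q = 0) : p = q := by
  have hz : horizontalPart p q = 0 := norm_le_zero_iff.1 (h ▸ norm_horizontalPart_le_dK p q)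
  have ht : verticalPart p q = 0 := by
    have := abs_verticalPart_le_sq_dK p q
    rw [h] at this
    simpa using this
  have h0 : p 0 = q 0 := sub_eq_zero.1 (congrArg Complex.re hz)
  have h1 : p 1 = q 1 := sub_eq_zero.1 (congrArg Complex.im hz)
  have h2 : p 2 = q 2 := by
    rw [verticalPart, h0, h1] at ht
    linarith
  ext i
  fin_cases i
  exacts [h0, h1, h2]

theorem continuous_dK_left (q : EuclideanSpace ℝ (Fin 3)) : Continuous fun p ↦ dK p q := by
  unfold dK
  refine Continuous.rpow_const (by fun_prop) fun _ ↦ Or.inr (by norm_num)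

/-- `ℝ³` with the Korányi distance. -/
structure KoranyiSpace where
  /-- The underlying point of `ℝ³`. -/
  toE3 : EuclideanSpace ℝ (Fin 3)

namespace KoranyiSpace

noncomputable instance : MetricSpace KoranyiSpace where
  dist x y := dK x.toE3 y.toE3
  dist_self x := dK_self x.toE3
  dist_comm x y := dK_comm x.toE3 y.toE3
  dist_triangle x y z := dK_triangle x.toE3 y.toE3 z.toE3
  eq_of_dist_eq_zero {x y} h := by
    cases x; cases y
    exact congrArg mk (eq_of_dK_eq_zero h)

theorem dist_eq (x y : KoranyiSpace) : dist x y = dK x.toE3 y.toE3 := rfl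

theorem continuous_mk : Continuous mk := by
  refine continuous_iff_continuousAt.2 fun p ↦ tendsto_iff_dist_tendsto_zero.2 ?_
  simpa only [dist_eq, dK_self] using (continuous_dK_left p).tendsto p

/-- The point whose difference from `x` has horizontal part `(a - x₀, b - x₁)` and vertical
part `c`. -/
noncomputable def chart (x : EuclideanSpace ℝ (Fin 3)) (v : ℝ × ℝ × ℝ) : EuclideanSpace ℝ (Fin 3) :=
  mk3 v.1 v.2.1 (x 2 + v.2.2 - 2 * (v.2.1 * x 0 - v.1 * x 1))

theorem continuous_chart (x : EuclideanSpace ℝ (Fin 3)) : Continuous (chart x) := by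
  refine (PiLp.continuous_toLp 2 _).comp (continuous_pi fun i ↦ ?_)
  fin_cases i <;> simp <;> fun_prop

theorem chart_verticalPart (x y : EuclideanSpace ℝ (Fin 3)) :
    chart x (y 0, y 1, verticalPart y x) = y := by
  ext i
  fin_cases i <;> simp [chart, mk3, verticalPart, add_sub_assoc]

theorem abs_sub_zero_le_dK (p q : EuclideanSpace ℝ (Fin 3)) : |p 0 - q 0| ≤ dK p q :=
  (Complex.abs_re_le_norm (horizontalPart p q)).trans (norm_horizontalPart_le_dK p q)

theorem abs_sub_one_le_dK (p q : EuclideanSpace ℝ (Fin 3)) : |p 1 - q 1| ≤ dK p q :=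
  (Complex.abs_im_le_norm (horizontalPart p q)).trans (norm_horizontalPart_le_dK p q)

theorem continuous_toE3 : Continuous toE3 := by
  refine continuous_iff_continuousAt.2 fun x ↦ ?_
  have hd : Tendsto (fun y ↦ dK y.toE3 x.toE3) (𝓝 x) (𝓝 0) :=
    tendsto_iff_dist_tendsto_zero.1 (tendsto_id (x := 𝓝 x))
  have h0 : Tendsto (fun y : KoranyiSpace ↦ y.toE3 0) (𝓝 x) (𝓝 (x.toE3 0)) :=
    tendsto_iff_dist_tendsto_zero.2 <|
      squeeze_zero (fun _ ↦ dist_nonneg) (fun y ↦ abs_sub_zero_le_dK y.toE3 x.toE3) hd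
  have h1 : Tendsto (fun y : KoranyiSpace ↦ y.toE3 1) (𝓝 x) (𝓝 (x.toE3 1)) :=
    tendsto_iff_dist_tendsto_zero.2 <|
      squeeze_zero (fun _ ↦ dist_nonneg) (fun y ↦ abs_sub_one_le_dK y.toE3 x.toE3) hd
  have h2 : Tendsto (fun y : KoranyiSpace ↦ verticalPart y.toE3 x.toE3) (𝓝 x)
      (𝓝 (verticalPart x.toE3 x.toE3)) := by
    have hv : verticalPart x.toE3 x.toE3 = 0 := by simp [verticalPart, mul_comm]
    rw [hv]
    exact squeeze_zero_norm (fun y ↦ abs_verticalPart_le_sq_dK y.toE3 x.toE3)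
      (by simpa using hd.pow 2)
  have h := ((continuous_chart x.toE3).tendsto _).comp
    (h0.prodMk_nhds (h1.prodMk_nhds h2))
  simpa only [ContinuousAt, Function.comp_def, chart_verticalPart] using h

instance : ProperSpace KoranyiSpace where
  isCompact_closedBall x r := by
    have hK : IsCompact ((mk ∘ chart x.toE3) ''
        (Metric.closedBall (x.toE3 0) r ×ˢ Metric.closedBall (x.toE3 1) r ×ˢ
          Metric.closedBall (0 : ℝ) (r ^ 2))) :=
      ((isCompact_closedBall _ _).prod ((isCompact_closedBall _ _).prod
        (isCompact_closedBall _ _))).image (continuous_mk.comp (continuous_chart _))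
    refine hK.of_isClosed_subset Metric.isClosed_closedBall fun y hy ↦ ?_
    rw [Metric.mem_closedBall, dist_eq] at hy
    refine ⟨(y.toE3 0, y.toE3 1, verticalPart y.toE3 x.toE3), ⟨?_, ?_, ?_⟩, ?_⟩
    · exact (abs_sub_zero_le_dK _ _).trans hy
    · exact (abs_sub_one_le_dK _ _).trans hy
    · rw [mem_closedBall_zero_iff]
      exact (abs_verticalPart_le_sq_dK _ _).trans (pow_le_pow_left₀ (dK_nonneg _ _) hy 2)
    · simp [chart_verticalPart]

end KoranyiSpace

theorem korLength_eq_eVariationOn (γ : ℝ → EuclideanSpace ℝ (Fin 3)) (a b : ℝ) :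
    korLength γ a b = eVariationOn (KoranyiSpace.mk ∘ γ) (Icc a b) :=
  iSup_isPartition_eq_eVariationOn (KoranyiSpace.mk ∘ γ) a b

end Koranyi

/-- between any two points of `ℝ³` there is a shortest continuous curve
(a geodesic) for the Korányi length. -/
theorem exists_koranyi_geodesic (p q : EuclideanSpace ℝ (Fin 3)) :
    ∃ γ : ℝ → EuclideanSpace ℝ (Fin 3),
      ContinuousOn γ (Icc 0 1) ∧ γ 0 = p ∧ γ 1 = q ∧
      korLength γ 0 1 =
        ⨅ (γ' : ℝ → EuclideanSpace ℝ (Fin 3))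
          (_ : ContinuousOn γ' (Icc 0 1) ∧ γ' 0 = p ∧ γ' 1 = q),
          korLength γ' 0 1 := by
  obtain ⟨f, ⟨hfc, hf0, hf1⟩, hmin⟩ := exists_continuousOn_eVariationOn_minimal
    (p := KoranyiSpace.mk p) (q := KoranyiSpace.mk q)
    ⟨KoranyiSpace.mk ∘ AffineMap.lineMap p q,
      (KoranyiSpace.continuous_mk.comp AffineMap.lineMap_continuous).continuousOn,
      by simp, by simp⟩
  have hγ : ContinuousOn (KoranyiSpace.toE3 ∘ f) (Icc 0 1) ∧
      (KoranyiSpace.toE3 ∘ f) 0 = p ∧ (KoranyiSpace.toE3 ∘ f) 1 = q :=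
    ⟨KoranyiSpace.continuous_toE3.comp_continuousOn hfc, by simp [hf0], by simp [hf1]⟩
  refine ⟨KoranyiSpace.toE3 ∘ f, hγ.1, hγ.2.1, hγ.2.2,
    le_antisymm (le_iInf₂ fun γ' hγ' ↦ ?_) (iInf₂_le (KoranyiSpace.toE3 ∘ f) hγ)⟩
  rw [korLength_eq_eVariationOn, korLength_eq_eVariationOn]
  exact hmin _ ⟨KoranyiSpace.continuous_mk.comp_continuousOn hγ'.1, by simp [hγ'.2.1],
    by simp [hγ'.2.2]⟩
end

section
/- If γ = (γ¹,γ²,γ³) : [0,1] → ℝ³ is twice continuously differentiable and horizontal, then its Korányi length is finite and equals its Carnot–Carathéodory length: L_K(γ) = ∫₀¹ √(γ̇¹(t)² + γ̇²(t)²) dt. -/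
open Set Filter

lemma korGauge_deriv_le {A B F u v r : ℝ} (hr : 0 < r)
    (h : (A ^ 2 + B ^ 2) ^ 2 + F ^ 2 ≤ r ^ 4) :
    (A ^ 2 + B ^ 2) * (A * u + B * v) - F * (A * v - B * u) ≤ r ^ 3 * Real.sqrt (u ^ 2 + v ^ 2) := by
  have hA : A ^ 2 + B ^ 2 ≤ r ^ 2 := by
    refine abs_le_of_sq_le_sq' ?_ (by positivity) |>.2
    nlinarith [sq_nonneg F]
  refine abs_le_of_sq_le_sq' ?_ (by positivity) |>.2
  have hS : Real.sqrt (u ^ 2 + v ^ 2) ^ 2 = u ^ 2 + v ^ 2 := Real.sq_sqrt (by positivity)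
  calc ((A ^ 2 + B ^ 2) * (A * u + B * v) - F * (A * v - B * u)) ^ 2
      ≤ ((A ^ 2 + B ^ 2) * ((A ^ 2 + B ^ 2) ^ 2 + F ^ 2)) * (u ^ 2 + v ^ 2) := by
        nlinarith [sq_nonneg ((A ^ 2 + B ^ 2) * (A * v - B * u) + F * (A * u + B * v))]
    _ ≤ (r ^ 2 * r ^ 4) * (u ^ 2 + v ^ 2) := by gcongr
    _ = (r ^ 3 * Real.sqrt (u ^ 2 + v ^ 2)) ^ 2 := by rw [mul_pow, hS]; ring

lemma dK_mk3 (x y z x' y' z' : ℝ) :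
    dK (mk3 x y z) (mk3 x' y' z') =
      (((x - x') ^ 2 + (y - y') ^ 2) ^ 2 + (z - z' + 2 * (y * x' - x * y')) ^ 2)
        ^ ((1 : ℝ) / 4) := by
  simp [dK, mk3, sq_abs]

lemma sqrt_le_dK_mk3 (x y z x' y' z' : ℝ) :
    Real.sqrt ((x - x') ^ 2 + (y - y') ^ 2) ≤ dK (mk3 x y z) (mk3 x' y' z') := by
  rw [dK_mk3]
  have h0 : (0 : ℝ) ≤ (x - x') ^ 2 + (y - y') ^ 2 := by positivity
  calc Real.sqrt ((x - x') ^ 2 + (y - y') ^ 2)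
      = (((x - x') ^ 2 + (y - y') ^ 2) ^ 2) ^ ((1 : ℝ) / 4) := by
        rw [Real.sqrt_eq_rpow, ← Real.rpow_natCast (_ + _) 2, ← Real.rpow_mul h0]
        norm_num
    _ ≤ _ := by
        gcongr
        nlinarith [sq_nonneg (z - z' + 2 * (y * x' - x * y'))]

/-- The Korányi distance between two points of a horizontal curve is at most the
Carnot–Carathéodory length of the arc between them. -/
lemma dK_le_integral_speed {γ₁ γ₂ γ₃ : ℝ → ℝ}
    (h₁ : ContDiff ℝ 1 γ₁) (h₂ : ContDiff ℝ 1 γ₂) (h₃ : ContDiff ℝ 1 γ₃) {s t : ℝ} (hst : s ≤ t)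
    (hhor : ∀ x ∈ Ioo s t, deriv γ₃ x = -2 * (γ₁ x * deriv γ₂ x - γ₂ x * deriv γ₁ x)) :
    dK (mk3 (γ₁ t) (γ₂ t) (γ₃ t)) (mk3 (γ₁ s) (γ₂ s) (γ₃ s)) ≤
      ∫ x in s..t, Real.sqrt ((deriv γ₁ x) ^ 2 + (deriv γ₂ x) ^ 2) := by
  rw [dK_mk3]
  refine le_of_forall_pos_le_add fun δ hδ => ?_
  let N : ℝ → ℝ := fun x => ((γ₁ x - γ₁ s) ^ 2 + (γ₂ x - γ₂ s) ^ 2) ^ 2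
    + (γ₃ x - γ₃ s + 2 * (γ₂ x * γ₁ s - γ₁ x * γ₂ s)) ^ 2
  have hN (x : ℝ) : 0 ≤ N x := by positivity
  have hpos (x : ℝ) : 0 < N x + δ ^ 4 := by have := hN x; positivity
  have hd₁ (x : ℝ) := (h₁.differentiable one_ne_zero x).hasDerivAt
  have hd₂ (x : ℝ) := (h₂.differentiable one_ne_zero x).hasDerivAt
  have hd₃ (x : ℝ) := (h₃.differentiable one_ne_zero x).hasDerivAt
  have hd (x : ℝ) := (((((hd₁ x).sub_const (γ₁ s)).pow 2).add
    (((hd₂ x).sub_const (γ₂ s)).pow 2)).pow 2).add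
    ((((hd₃ x).sub_const (γ₃ s)).add
      ((((hd₂ x).mul_const (γ₁ s)).sub ((hd₁ x).mul_const (γ₂ s))).const_mul 2)).pow 2)
  have hg (x : ℝ) := ((hd x).add_const (δ ^ 4)).rpow_const (p := 1 / 4) (Or.inl (hpos x).ne')
  have key := intervalIntegral.sub_le_integral_of_hasDeriv_right_of_le
    (φ := fun x => Real.sqrt ((deriv γ₁ x) ^ 2 + (deriv γ₂ x) ^ 2)) hst
    (fun x _ => (hg x).continuousAt.continuousWithinAt)
    (fun x _ => (hg x).hasDerivWithinAt) ?_ ?_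
  · have hs : (δ ^ 4) ^ ((1 : ℝ) / 4) = δ := by
      rw [← Real.rpow_natCast, ← Real.rpow_mul hδ.le]; norm_num
    have h1 : N t ^ ((1 : ℝ) / 4) ≤ (N t + δ ^ 4) ^ ((1 : ℝ) / 4) := by
      have := hN t
      gcongr
      have : 0 < δ ^ 4 := by positivity
      linarith
    have h2 : (N s + δ ^ 4) ^ ((1 : ℝ) / 4) = δ := by
      rw [← hs]; congr 1; simp only [N]; rw [hs]; ring
    change (N t + δ ^ 4) ^ ((1 : ℝ) / 4) - (N s + δ ^ 4) ^ ((1 : ℝ) / 4) ≤ _ at key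
    change N t ^ ((1 : ℝ) / 4) ≤ _
    linarith
  · have c₁ := h₁.continuous_deriv le_rfl
    have c₂ := h₂.continuous_deriv le_rfl
    exact Continuous.integrableOn_Icc (by fun_prop)
  · intro x hx
    set r := (N x + δ ^ 4) ^ ((1 : ℝ) / 4) with hr
    have hrpos : 0 < r := Real.rpow_pos_of_pos (hpos x) _
    have hr4 : r ^ 4 = N x + δ ^ 4 := by
      rw [hr, ← Real.rpow_natCast, ← Real.rpow_mul (hpos x).le]; norm_num
    have hr3 : (N x + δ ^ 4) ^ ((1 : ℝ) / 4 - 1) = (r ^ 3)⁻¹ := by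
      rw [hr, ← Real.rpow_natCast _ 3, ← Real.rpow_mul (hpos x).le, ← Real.rpow_neg (hpos x).le]
      norm_num
    have hle : N x ≤ r ^ 4 := by
      have : 0 < δ ^ 4 := by positivity
      linarith
    have hmain := korGauge_deriv_le (u := deriv γ₁ x) (v := deriv γ₂ x) hrpos hle
    change _ * (1 / 4) * (N x + δ ^ 4) ^ ((1 : ℝ) / 4 - 1) ≤ _
    rw [hr3, ← div_eq_mul_inv, div_le_iff₀ (by positivity), hhor x hx]
    refine (le_of_eq ?_).trans (hmain.trans_eq (mul_comm _ _))
    simp only [Pi.add_apply, Pi.sub_apply, Pi.pow_apply]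
    push_cast
    ring

/-- A `C¹` arc along which the velocity oscillates by at most `ε` has length close to that of
its chord. -/
lemma integral_norm_deriv_le_of_oscillation {E : Type*} [NormedAddCommGroup E] [NormedSpace ℝ E]
    {c : ℝ → E} (hc : ContDiff ℝ 1 c) {s t ε : ℝ} (hst : s ≤ t)
    (hε : ∀ x ∈ Icc s t, ‖deriv c x - deriv c s‖ ≤ ε) :
    ∫ x in s..t, ‖deriv c x‖ ≤ ‖c t - c s‖ + 2 * ε * (t - s) := by
  have hcd := hc.continuous_deriv le_rfl
  have hint : ∫ x in s..t, ‖deriv c x‖ ≤ ∫ _ in s..t, (‖deriv c s‖ + ε) := by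
    refine intervalIntegral.integral_mono_on hst (hcd.norm.intervalIntegrable _ _)
      intervalIntegrable_const fun x hx => ?_
    have := norm_le_norm_add_norm_sub' (deriv c x) (deriv c s)
    linarith [hε x hx]
  rw [intervalIntegral.integral_const, smul_eq_mul] at hint
  have hchord : ‖(c t - t • deriv c s) - (c s - s • deriv c s)‖ ≤ ε * ‖t - s‖ := by
    refine (convex_Icc s t).norm_image_sub_le_of_norm_hasDerivWithin_le
      (f := fun x => c x - x • deriv c s) (f' := fun x => deriv c x - deriv c s)
      (fun x _ => ?_) hε (left_mem_Icc.2 hst) (right_mem_Icc.2 hst)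
    have h := (hc.differentiable one_ne_zero x).hasDerivAt.sub
      ((hasDerivAt_id x).smul_const (deriv c s))
    rw [one_smul] at h
    exact h.hasDerivWithinAt
  have hsub : (t - s) • deriv c s
      = (c t - c s) - ((c t - t • deriv c s) - (c s - s • deriv c s)) := by
    rw [sub_smul]; abel
  have hnorm := norm_sub_le (c t - c s) ((c t - t • deriv c s) - (c s - s • deriv c s))
  rw [← hsub, norm_smul, Real.norm_of_nonneg (sub_nonneg.2 hst)] at hnorm
  rw [Real.norm_of_nonneg (sub_nonneg.2 hst)] at hchord
  linarith

/-- The length of a `C¹` curve is approximated by inscribed polygons. -/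
lemma exists_partition_integral_norm_deriv_le {E : Type*} [NormedAddCommGroup E]
    [NormedSpace ℝ E] {c : ℝ → E} (hc : ContDiff ℝ 1 c) {ε : ℝ} (hε : 0 < ε) :
    ∃ (n : ℕ) (t : ℕ → ℝ), IsPartition 0 1 n t ∧
      ∫ x in (0 : ℝ)..1, ‖deriv c x‖ ≤
        ∑ i ∈ Finset.range n, ‖c (t (i + 1)) - c (t i)‖ + ε := by
  have hcd := hc.continuous_deriv le_rfl
  obtain ⟨δ, hδ, hunif⟩ := Metric.uniformContinuousOn_iff.1
    (isCompact_Icc.uniformContinuousOn_of_continuous (hcd.continuousOn (s := Icc (0 : ℝ) 1)))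
    (ε / 2) (half_pos hε)
  obtain ⟨m, hm⟩ := exists_nat_one_div_lt hδ
  have hm0 : (0 : ℝ) < (m : ℝ) + 1 := by positivity
  let t : ℕ → ℝ := fun i => i / ((m : ℝ) + 1)
  have hstep (i : ℕ) : t (i + 1) - t i = 1 / ((m : ℝ) + 1) := by
    simp only [t]; push_cast; field_simp; ring
  have hlt (i : ℕ) : t i < t (i + 1) := by
    have : 0 < 1 / ((m : ℝ) + 1) := by positivity
    linarith [hstep i]
  have ht0 : t 0 = 0 := by simp [t]
  have ht1 : t (m + 1) = 1 := by simp only [t]; push_cast; exact div_self hm0.ne'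
  refine ⟨m + 1, t, ⟨ht0, ht1, fun i _ => hlt i⟩, ?_⟩
  have hmono : StrictMono t := strictMono_nat_of_lt_succ hlt
  have hsum := intervalIntegral.sum_integral_adjacent_intervals (a := t) (n := m + 1)
    (f := fun x => ‖deriv c x‖) (μ := MeasureTheory.volume)
    fun i _ => hcd.norm.intervalIntegrable _ _
  rw [ht0, ht1] at hsum
  have htel : ∑ i ∈ Finset.range (m + 1), (t (i + 1) - t i) = 1 := by
    rw [Finset.sum_range_sub, ht0, ht1, sub_zero]
  calc ∫ x in (0 : ℝ)..1, ‖deriv c x‖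
      = ∑ i ∈ Finset.range (m + 1), ∫ x in t i..t (i + 1), ‖deriv c x‖ := hsum.symm
    _ ≤ ∑ i ∈ Finset.range (m + 1),
          (‖c (t (i + 1)) - c (t i)‖ + 2 * (ε / 2) * (t (i + 1) - t i)) := by
        refine Finset.sum_le_sum fun i hi => ?_
        refine integral_norm_deriv_le_of_oscillation hc (hlt i).le fun x hx => ?_
        have hi0 : 0 ≤ t i := ht0 ▸ hmono.monotone (Nat.zero_le i)
        have hi1 : t (i + 1) ≤ 1 := ht1 ▸ hmono.monotone (Finset.mem_range.1 hi)
        rw [← dist_eq_norm]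
        refine (hunif x ⟨hi0.trans hx.1, hx.2.trans hi1⟩ (t i)
          ⟨hi0, (hlt i).le.trans hi1⟩ ?_).le
        rw [Real.dist_eq, abs_of_nonneg (sub_nonneg.2 hx.1)]
        linarith [hstep i, hx.2]
    _ = _ := by
        rw [Finset.sum_add_distrib, ← Finset.mul_sum, htel]; ring

lemma IsPartition.monotoneOn {a b : ℝ} {n : ℕ} {t : ℕ → ℝ} (ht : IsPartition a b n t) :
    MonotoneOn t (Iic n) := by
  intro i _ j hj hij
  induction j, hij using Nat.le_induction with
  | base => exact le_rfl
  | succ k hk ih => exact (ih (Nat.le_of_succ_le hj)).trans (ht.2.2 k hj).le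

/-- for a twice continuously differentiable horizontal curve, the Korányi
length is finite and equals the Carnot–Carathéodory length `∫₀¹ √(γ̇¹² + γ̇²²)`. -/
theorem korLength_eq_ccLength (γ₁ γ₂ γ₃ : ℝ → ℝ)
    (h₁ : ContDiff ℝ 2 γ₁) (h₂ : ContDiff ℝ 2 γ₂) (h₃ : ContDiff ℝ 2 γ₃)
    (hhor : ∀ t ∈ Ioo (0 : ℝ) 1,
      deriv γ₃ t = -2 * (γ₁ t * deriv γ₂ t - γ₂ t * deriv γ₁ t)) :
    korLength (fun t => mk3 (γ₁ t) (γ₂ t) (γ₃ t)) 0 1 ≠ ⊤ ∧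
    korLength (fun t => mk3 (γ₁ t) (γ₂ t) (γ₃ t)) 0 1 =
      ENNReal.ofReal (∫ t in (0 : ℝ)..1, Real.sqrt ((deriv γ₁ t) ^ 2 + (deriv γ₂ t) ^ 2)) := by
  replace h₁ : ContDiff ℝ 1 γ₁ := h₁.of_le one_le_two
  replace h₂ : ContDiff ℝ 1 γ₂ := h₂.of_le one_le_two
  replace h₃ : ContDiff ℝ 1 γ₃ := h₃.of_le one_le_two
  suffices h : korLength (fun t => mk3 (γ₁ t) (γ₂ t) (γ₃ t)) 0 1 =
      ENNReal.ofReal (∫ t in (0 : ℝ)..1, Real.sqrt ((deriv γ₁ t) ^ 2 + (deriv γ₂ t) ^ 2)) from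
    ⟨h ▸ ENNReal.ofReal_ne_top, h⟩
  have c₁ := h₁.continuous_deriv le_rfl
  have c₂ := h₂.continuous_deriv le_rfl
  apply le_antisymm
  · refine iSup_le fun n => iSup_le fun t => iSup_le fun ht => ENNReal.ofReal_le_ofReal ?_
    have hsum := intervalIntegral.sum_integral_adjacent_intervals (a := t) (n := n)
      (f := fun x => Real.sqrt ((deriv γ₁ x) ^ 2 + (deriv γ₂ x) ^ 2)) (μ := MeasureTheory.volume)
      fun i _ => Continuous.intervalIntegrable (by fun_prop) _ _
    rw [ht.1, ht.2.1] at hsum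
    rw [← hsum]
    refine Finset.sum_le_sum fun i hi => ?_
    have hin := Finset.mem_range.1 hi
    refine dK_le_integral_speed h₁ h₂ h₃ (ht.2.2 i hin).le fun x hx => hhor x ⟨?_, ?_⟩
    · refine lt_of_le_of_lt ?_ hx.1
      rw [← ht.1]
      exact ht.monotoneOn (Nat.zero_le n) hin.le (Nat.zero_le i)
    · refine hx.2.trans_le ?_
      rw [← ht.2.1]
      exact ht.monotoneOn hin (le_refl n) hin
  · let c : ℝ → ℂ := fun x => ⟨γ₁ x, γ₂ x⟩
    have hceq : c = fun x => (γ₁ x : ℂ) + (γ₂ x : ℂ) * Complex.I := by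
      funext x; exact Complex.mk_eq_add_mul_I _ _
    have hc : ContDiff ℝ 1 c := by
      rw [hceq]
      exact (Complex.ofRealCLM.contDiff.comp h₁).add
        ((Complex.ofRealCLM.contDiff.comp h₂).mul contDiff_const)
    have hnorm (z : ℂ) : ‖z‖ = Real.sqrt (z.re ^ 2 + z.im ^ 2) := by
      rw [Complex.norm_eq_sqrt_sq_add_sq]
    have hdc (x : ℝ) : ‖deriv c x‖ = Real.sqrt ((deriv γ₁ x) ^ 2 + (deriv γ₂ x) ^ 2) := by
      have hd := ((h₁.differentiable one_ne_zero x).hasDerivAt.ofReal_comp).add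
        (((h₂.differentiable one_ne_zero x).hasDerivAt.ofReal_comp).mul_const Complex.I)
      have : deriv c x = ((deriv γ₁ x : ℝ) : ℂ) + ((deriv γ₂ x : ℝ) : ℂ) * Complex.I := by
        rw [hceq]; exact hd.deriv
      rw [hnorm, this]; simp
    simp_rw [← hdc]
    refine ENNReal.le_of_forall_pos_le_add fun ε hε _ => ?_
    obtain ⟨n, t, ht, hle⟩ := exists_partition_integral_norm_deriv_le hc (NNReal.coe_pos.2 hε)
    refine (ENNReal.ofReal_le_ofReal hle).trans (ENNReal.ofReal_add_le.trans ?_)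
    rw [ENNReal.ofReal_coe_nnreal]
    gcongr
    refine le_trans (ENNReal.ofReal_le_ofReal ?_)
      (le_iSup_of_le n (le_iSup_of_le t (le_iSup_of_le ht le_rfl)))
    refine Finset.sum_le_sum fun i _ => ?_
    rw [hnorm]
    exact sqrt_le_dK_mk3 _ _ _ _ _ _
end

section
/- Let γ = (γ¹,γ²,γ³) : [0,1] → ℝ³ be twice continuously differentiable and horizontal. Then, uniformly in t ∈ [0,1], the quantity [(γ³(t) - γ³(s))/(t-s) + 2((γ²(t) - γ²(s))·γ¹(s) - (γ¹(t) - γ¹(s))·γ²(s))/(t-s)] / (t-s) tends to 0 as s → t; i.e., for every ε > 0 there is δ > 0 such that for all s, t ∈ [0,1] with 0 < |t - s| < δ, |γ³(t) - γ³(s) + 2((γ²(t) - γ²(s))γ¹(s) - (γ¹(t) - γ¹(s))γ²(s))| ≤ ε·(t-s)². -/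
open Set Filter

/-- On a compact interval, the first-order Taylor remainder of a `C¹` function is uniformly
`o(|u - s|)`. -/
theorem ContDiff.exists_abs_sub_sub_deriv_mul_le {f : ℝ → ℝ} (hf : ContDiff ℝ 1 f) (a b : ℝ)
    {ε : ℝ} (hε : 0 < ε) :
    ∃ δ > 0, ∀ s ∈ Icc a b, ∀ u ∈ Icc a b, |u - s| < δ →
      |f u - f s - deriv f u * (u - s)| ≤ ε * |u - s| := by
  have huc : UniformContinuousOn (deriv f) (Icc a b) :=
    isCompact_Icc.uniformContinuousOn_of_continuous (hf.continuous_deriv le_rfl).continuousOn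
  obtain ⟨δ, hδ, h⟩ := Metric.uniformContinuousOn_iff.1 huc ε hε
  refine ⟨δ, hδ, fun s hs u hu hsu => ?_⟩
  have hderiv : ∀ x ∈ uIcc s u,
      HasDerivWithinAt (fun y => f y - deriv f u * y) (deriv f x - deriv f u) (uIcc s u) x := by
    intro x _
    have := ((hf.differentiable one_ne_zero x).hasDerivAt).sub
      ((hasDerivAt_id x).const_mul (deriv f u))
    rw [mul_one] at this
    exact this.hasDerivWithinAt
  have hbound : ∀ x ∈ uIcc s u, ‖deriv f x - deriv f u‖ ≤ ε := by
    intro x hx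
    refine (h x (uIcc_subset_Icc hs hu hx) u hu ?_).le
    rw [dist_comm]
    exact (abs_sub_right_of_mem_uIcc hx).trans_lt hsu
  have := (convex_uIcc s u).norm_image_sub_le_of_norm_hasDerivWithin_le hderiv hbound
    left_mem_uIcc right_mem_uIcc
  simp only [Real.norm_eq_abs] at this
  convert this using 2
  ring

/-- A `C¹` curve that is horizontal on `(0, 1)` is horizontal on `[0, 1]`. -/
theorem horizontal_on_Icc {γ₁ γ₂ γ₃ : ℝ → ℝ}
    (h₁ : ContDiff ℝ 1 γ₁) (h₂ : ContDiff ℝ 1 γ₂) (h₃ : ContDiff ℝ 1 γ₃)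
    (hhor : ∀ t ∈ Ioo (0 : ℝ) 1,
      deriv γ₃ t = -2 * (γ₁ t * deriv γ₂ t - γ₂ t * deriv γ₁ t)) :
    ∀ t ∈ Icc (0 : ℝ) 1, deriv γ₃ t = -2 * (γ₁ t * deriv γ₂ t - γ₂ t * deriv γ₁ t) := by
  have c₁ := h₁.continuous
  have c₂ := h₂.continuous
  have d₁ := h₁.continuous_deriv le_rfl
  have d₂ := h₂.continuous_deriv le_rfl
  have heq : EqOn (deriv γ₃) (fun t => -2 * (γ₁ t * deriv γ₂ t - γ₂ t * deriv γ₁ t))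
      (Ioo (0 : ℝ) 1) := hhor
  have := heq.closure (h₃.continuous_deriv le_rfl) (by fun_prop)
  rwa [closure_Ioo zero_ne_one] at this

/-- for a twice continuously differentiable horizontal curve
`γ = (γ¹,γ²,γ³) : [0,1] → ℝ³`, the quantity
`(γ³(t) - γ³(s) + 2((γ²(t)-γ²(s))γ¹(s) - (γ¹(t)-γ¹(s))γ²(s)))/(t-s)²` tends to `0`
as `s → t`, uniformly in `t`. -/
theorem horizontal_second_order_estimate (γ₁ γ₂ γ₃ : ℝ → ℝ)
    (h₁ : ContDiff ℝ 2 γ₁) (h₂ : ContDiff ℝ 2 γ₂) (h₃ : ContDiff ℝ 2 γ₃)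
    (hhor : ∀ t ∈ Ioo (0 : ℝ) 1,
      deriv γ₃ t = -2 * (γ₁ t * deriv γ₂ t - γ₂ t * deriv γ₁ t)) :
    ∀ ε > 0, ∃ δ > 0, ∀ s ∈ Icc (0 : ℝ) 1, ∀ t ∈ Icc (0 : ℝ) 1,
      0 < |t - s| → |t - s| < δ →
      |γ₃ t - γ₃ s + 2 * ((γ₂ t - γ₂ s) * γ₁ s - (γ₁ t - γ₁ s) * γ₂ s)|
        ≤ ε * (t - s) ^ 2 := by
  intro ε hε
  replace h₁ : ContDiff ℝ 1 γ₁ := h₁.of_le one_le_two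
  replace h₂ : ContDiff ℝ 1 γ₂ := h₂.of_le one_le_two
  replace h₃ : ContDiff ℝ 1 γ₃ := h₃.of_le one_le_two
  replace hhor := horizontal_on_Icc h₁ h₂ h₃ hhor
  obtain ⟨M₁, hM₁⟩ := (isCompact_Icc (a := (0 : ℝ)) (b := 1)).exists_bound_of_continuousOn
    (h₁.continuous_deriv le_rfl).continuousOn
  obtain ⟨M₂, hM₂⟩ := (isCompact_Icc (a := (0 : ℝ)) (b := 1)).exists_bound_of_continuousOn
    (h₂.continuous_deriv le_rfl).continuousOn
  have hM₁0 : 0 ≤ M₁ := (norm_nonneg _).trans (hM₁ 0 (by simp))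
  have hM₂0 : 0 ≤ M₂ := (norm_nonneg _).trans (hM₂ 0 (by simp))
  set η := ε / (2 * (M₁ + M₂ + 1)) with hη
  have hη0 : 0 < η := by positivity
  have hηε : 2 * (η * (M₁ + M₂)) ≤ ε := by
    have : ε = 2 * (η * (M₁ + M₂ + 1)) := by rw [hη]; field_simp
    linarith
  obtain ⟨δ₁, hδ₁, H₁⟩ := h₁.exists_abs_sub_sub_deriv_mul_le 0 1 hη0
  obtain ⟨δ₂, hδ₂, H₂⟩ := h₂.exists_abs_sub_sub_deriv_mul_le 0 1 hη0
  refine ⟨min δ₁ δ₂, lt_min hδ₁ hδ₂, fun s hs t ht _ hst => ?_⟩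
  have hderiv : ∀ u ∈ uIcc s t, HasDerivWithinAt
      (fun v => γ₃ v - γ₃ s + 2 * ((γ₂ v - γ₂ s) * γ₁ s - (γ₁ v - γ₁ s) * γ₂ s))
      (deriv γ₃ u + 2 * (deriv γ₂ u * γ₁ s - deriv γ₁ u * γ₂ s)) (uIcc s t) u := by
    intro u _
    have e₁ := (h₁.differentiable one_ne_zero u).hasDerivAt
    have e₂ := (h₂.differentiable one_ne_zero u).hasDerivAt
    have e₃ := (h₃.differentiable one_ne_zero u).hasDerivAt
    exact ((e₃.sub_const _).add ((((e₂.sub_const _).mul_const _).sub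
      ((e₁.sub_const _).mul_const _)).const_mul 2)).hasDerivWithinAt
  have hbound : ∀ u ∈ uIcc s t,
      ‖deriv γ₃ u + 2 * (deriv γ₂ u * γ₁ s - deriv γ₁ u * γ₂ s)‖ ≤ ε * |t - s| := by
    intro u hu
    have hu' := uIcc_subset_Icc hs ht hu
    have hus : |u - s| ≤ |t - s| := abs_sub_left_of_mem_uIcc hu
    have hlt := hus.trans_lt hst
    have R₁ := H₁ s hs u hu' (hlt.trans_le (min_le_left _ _))
    have R₂ := H₂ s hs u hu' (hlt.trans_le (min_le_right _ _))
    have B₁ := hM₁ u hu'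
    have B₂ := hM₂ u hu'
    rw [Real.norm_eq_abs] at B₁ B₂ ⊢
    calc |deriv γ₃ u + 2 * (deriv γ₂ u * γ₁ s - deriv γ₁ u * γ₂ s)|
        = 2 * |(γ₂ u - γ₂ s - deriv γ₂ u * (u - s)) * deriv γ₁ u
            - (γ₁ u - γ₁ s - deriv γ₁ u * (u - s)) * deriv γ₂ u| := by
          rw [hhor u hu', ← abs_two, ← abs_mul, abs_two]
          congr 1
          ring
      _ ≤ 2 * (η * |u - s| * M₁ + η * |u - s| * M₂) := by
          gcongr
          refine (abs_sub _ _).trans ?_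
          rw [abs_mul, abs_mul]
          gcongr
      _ = 2 * (η * (M₁ + M₂)) * |u - s| := by ring
      _ ≤ ε * |t - s| := by gcongr
  have := (convex_uIcc s t).norm_image_sub_le_of_norm_hasDerivWithin_le hderiv hbound
    left_mem_uIcc right_mem_uIcc
  simpa [mul_assoc, ← pow_two] using this
end

section
/- Let γ = (γ¹,γ²,γ³) : [0,1] → ℝ³ be twice continuously differentiable and horizontal. Then d_K(γ(t), γ(s))/|t - s| converges to √(γ̇¹(t)² + γ̇²(t)²) as s → t, and the convergence is uniform in t ∈ [0,1]: for every ε > 0 there is δ > 0 such that for all s, t ∈ [0,1] with 0 < |t - s| < δ, |d_K(γ(t),γ(s))/|t-s| - √(γ̇¹(t)² + γ̇²(t)²)| < ε. -/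
open Set Filter

/-- A function with derivative bounded by `C` on the segment between `s` and `t` changes by at most
`C * |t - s|`. -/
lemma abs_sub_le_of_abs_deriv_le {f f' : ℝ → ℝ} {C s t : ℝ} (hf : ∀ x, HasDerivAt f (f' x) x)
    (hC : ∀ x ∈ uIcc s t, |f' x| ≤ C) : |f t - f s| ≤ C * |t - s| := by
  simpa only [Real.norm_eq_abs] using
    (convex_uIcc s t).norm_image_sub_le_of_norm_hasDerivWithin_le
      (fun x _ ↦ (hf x).hasDerivWithinAt) (fun x hx ↦ by simpa using hC x hx)
      left_mem_uIcc right_mem_uIcc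

lemma exists_abs_le_on_Icc {f : ℝ → ℝ} (hf : Continuous f) (a b : ℝ) :
    ∃ D, 0 ≤ D ∧ ∀ t ∈ Icc a b, |f t| ≤ D := by
  obtain ⟨D, hD⟩ := (isCompact_Icc (a := a) (b := b)).exists_bound_of_continuousOn hf.continuousOn
  exact ⟨max D 0, le_max_right _ _, fun t ht ↦ (hD t ht).trans (le_max_left _ _)⟩

/-- The first-order Taylor expansion of a `C²` function has a uniformly quadratic remainder on a
compact interval. -/
lemma exists_taylor_remainder_le {f : ℝ → ℝ} (hf : ContDiff ℝ 2 f) (a b : ℝ) :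
    ∃ M, 0 ≤ M ∧ ∀ s ∈ Icc a b, ∀ t ∈ Icc a b,
      |f t - f s - deriv f t * (t - s)| ≤ M * |t - s| ^ 2 := by
  have hf' : ContDiff ℝ 1 (deriv f) := ((contDiff_succ_iff_deriv (n := 1)).1 hf).2.2
  obtain ⟨M, hM0, hM⟩ := exists_abs_le_on_Icc (hf'.continuous_deriv le_rfl) a b
  refine ⟨M, hM0, fun s hs t ht ↦ ?_⟩
  have hd : ∀ x, HasDerivAt f (deriv f x) x := fun x ↦
    (hf.differentiable (by norm_num) x).hasDerivAt
  have hd' : ∀ x, HasDerivAt (deriv f) (deriv (deriv f) x) x := fun x ↦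
    (hf'.differentiable (by norm_num) x).hasDerivAt
  have hderiv : ∀ x, HasDerivAt (fun x ↦ f x - deriv f t * x) (deriv f x - deriv f t) x := by
    intro x
    simpa only [mul_one] using (hd x).fun_sub ((hasDerivAt_id' x).const_mul (deriv f t))
  have hbound : ∀ x ∈ uIcc s t, |deriv f x - deriv f t| ≤ M * |t - s| := by
    intro x hx
    have hxI : x ∈ Icc a b := uIcc_subset_Icc hs ht hx
    refine (abs_sub_le_of_abs_deriv_le hd' fun y hy ↦
      hM y (uIcc_subset_Icc ht hxI hy)).trans ?_
    rw [abs_sub_comm x t]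
    exact mul_le_mul_of_nonneg_left (abs_sub_right_of_mem_uIcc hx) hM0
  calc |f t - f s - deriv f t * (t - s)|
      = |(f t - deriv f t * t) - (f s - deriv f t * s)| := by congr 1; ring
    _ ≤ M * |t - s| * |t - s| := abs_sub_le_of_abs_deriv_le hderiv hbound
    _ = M * |t - s| ^ 2 := by ring

lemma abs_sqrt_sq_add_sq_sub_le (a b c d : ℝ) :
    |√(a ^ 2 + b ^ 2) - √(c ^ 2 + d ^ 2)| ≤ |a - c| + |b - d| := by
  have key : ∀ a b c d : ℝ, √(a ^ 2 + b ^ 2) ≤ √(c ^ 2 + d ^ 2) + (|a - c| + |b - d|) := by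
    intro a b c d
    have hc : |c| ≤ √(c ^ 2 + d ^ 2) := Real.abs_le_sqrt (by nlinarith [sq_nonneg d])
    have hd : |d| ≤ √(c ^ 2 + d ^ 2) := Real.abs_le_sqrt (by nlinarith [sq_nonneg c])
    have hS := Real.sq_sqrt (by positivity : 0 ≤ c ^ 2 + d ^ 2)
    apply Real.sqrt_le_iff.2
    refine ⟨by positivity, ?_⟩
    have h1 : c * (a - c) ≤ √(c ^ 2 + d ^ 2) * |a - c| :=
      (le_abs_self _).trans (by rw [abs_mul]; gcongr)
    have h2 : d * (b - d) ≤ √(c ^ 2 + d ^ 2) * |b - d| :=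
      (le_abs_self _).trans (by rw [abs_mul]; gcongr)
    nlinarith [sq_abs (a - c), sq_abs (b - d), mul_nonneg (abs_nonneg (a - c)) (abs_nonneg (b - d))]
  rw [abs_sub_le_iff]
  have h1 := key a b c d
  have h2 := key c d a b
  rw [abs_sub_comm c a, abs_sub_comm d b] at h2
  constructor <;> linarith

lemma abs_rpow_fourth_sub_sqrt_le {S : ℝ} (hS : 0 ≤ S) (C : ℝ) :
    |(S ^ 2 + C ^ 2) ^ ((1 : ℝ) / 4) - √S| ≤ √|C| := by
  have hroot : ∀ x : ℝ, 0 ≤ x → (x ^ 4) ^ ((1 : ℝ) / 4) = x := fun x hx ↦ by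
    simpa using Real.pow_rpow_inv_natCast hx (n := 4) (by norm_num)
  have hs := Real.sq_sqrt hS
  have hc := Real.sq_sqrt (abs_nonneg C)
  have hs0 := Real.sqrt_nonneg S
  have hc0 := Real.sqrt_nonneg |C|
  have hS4 : S ^ 2 = √S ^ 4 := by rw [← hs]; ring_nf; rw [hs]
  have hC4 : C ^ 2 = √|C| ^ 4 := by
    calc C ^ 2 = (√|C| ^ 2) ^ 2 := by rw [hc, sq_abs]
      _ = √|C| ^ 4 := by ring
  have lower : √S ≤ (S ^ 2 + C ^ 2) ^ ((1 : ℝ) / 4) := by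
    rw [← hroot (√S) hs0, ← hS4]
    exact Real.rpow_le_rpow (by positivity) (by nlinarith [sq_nonneg C]) (by norm_num)
  have upper : (S ^ 2 + C ^ 2) ^ ((1 : ℝ) / 4) ≤ √S + √|C| := by
    rw [← hroot (√S + √|C|) (by positivity)]
    refine Real.rpow_le_rpow (by positivity) ?_ (by norm_num)
    rw [hS4, hC4]
    have : 0 ≤ 4 * √S ^ 3 * √|C| + 6 * √S ^ 2 * √|C| ^ 2 + 4 * √S * √|C| ^ 3 := by positivity
    nlinarith
  rw [abs_sub_le_iff]
  constructor <;> linarith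

/-- The Korányi distance is homogeneous of degree one under Heisenberg dilations. -/
lemma dK_mk3_div {h : ℝ} (hh : h ≠ 0) (x y z x' y' z' : ℝ) :
    dK (mk3 x y z) (mk3 x' y' z') / |h| =
      ((((x - x') / h) ^ 2 + ((y - y') / h) ^ 2) ^ 2
        + ((z - z' + 2 * (y * x' - x * y')) / h ^ 2) ^ 2) ^ ((1 : ℝ) / 4) := by
  have hroot : |h| = (|h| ^ 4) ^ ((1 : ℝ) / 4) := by
    simpa using (Real.pow_rpow_inv_natCast (abs_nonneg h) (n := 4) (by norm_num)).symm
  have heven : |h| ^ 4 = h ^ 4 := Even.pow_abs (by decide) h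
  rw [hroot, heven]
  simp only [dK, mk3, WithLp.equiv_symm_apply, Matrix.cons_val_zero, Matrix.cons_val_one,
    Matrix.cons_val, sq_abs]
  rw [← Real.div_rpow (by positivity) (by positivity)]
  congr 1
  field_simp

/-- Along a `C²` horizontal curve, the vertical part of the Korányi distance is of third order. -/
lemma exists_vertical_le {γ₁ γ₂ γ₃ : ℝ → ℝ} (h₁ : ContDiff ℝ 2 γ₁) (h₂ : ContDiff ℝ 2 γ₂)
    (h₃ : Differentiable ℝ γ₃) {a b : ℝ}
    (hhor : ∀ t ∈ Icc a b, deriv γ₃ t = -2 * (γ₁ t * deriv γ₂ t - γ₂ t * deriv γ₁ t)) :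
    ∃ K, ∀ s ∈ Icc a b, ∀ t ∈ Icc a b,
      |γ₃ t - γ₃ s + 2 * (γ₂ t * γ₁ s - γ₁ t * γ₂ s)| ≤ K * |t - s| ^ 3 := by
  obtain ⟨M₁, hM₁, hT₁⟩ := exists_taylor_remainder_le h₁ a b
  obtain ⟨M₂, hM₂, hT₂⟩ := exists_taylor_remainder_le h₂ a b
  obtain ⟨D₁, hD₁, hB₁⟩ := exists_abs_le_on_Icc (h₁.continuous_deriv (by norm_num)) a b
  obtain ⟨D₂, hD₂, hB₂⟩ := exists_abs_le_on_Icc (h₂.continuous_deriv (by norm_num)) a b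
  refine ⟨2 * (D₁ * M₂ + D₂ * M₁), fun s hs t ht ↦ ?_⟩
  have hd₁ : ∀ x, HasDerivAt γ₁ (deriv γ₁ x) x := fun x ↦
    (h₁.differentiable (by norm_num) x).hasDerivAt
  have hd₂ : ∀ x, HasDerivAt γ₂ (deriv γ₂ x) x := fun x ↦
    (h₂.differentiable (by norm_num) x).hasDerivAt
  have hderiv : ∀ x, HasDerivAt (fun x ↦ γ₃ x + 2 * (γ₂ x * γ₁ s - γ₁ x * γ₂ s))
      (deriv γ₃ x + 2 * (deriv γ₂ x * γ₁ s - deriv γ₁ x * γ₂ s)) x := fun x ↦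
    (h₃ x).hasDerivAt.add
      ((((hd₂ x).mul_const (γ₁ s)).sub ((hd₁ x).mul_const (γ₂ s))).const_mul 2)
  have hbound : ∀ x ∈ uIcc s t, |deriv γ₃ x + 2 * (deriv γ₂ x * γ₁ s - deriv γ₁ x * γ₂ s)| ≤
      2 * (D₁ * M₂ + D₂ * M₁) * |t - s| ^ 2 := by
    intro x hx
    have hxI : x ∈ Icc a b := uIcc_subset_Icc hs ht hx
    have hxs : |x - s| ≤ |t - s| := abs_sub_left_of_mem_uIcc hx
    set e₁ := γ₁ x - γ₁ s - deriv γ₁ x * (x - s)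
    set e₂ := γ₂ x - γ₂ s - deriv γ₂ x * (x - s)
    have he₁ : |e₁| ≤ M₁ * |t - s| ^ 2 := (hT₁ s hs x hxI).trans (by gcongr)
    have he₂ : |e₂| ≤ M₂ * |t - s| ^ 2 := (hT₂ s hs x hxI).trans (by gcongr)
    calc |deriv γ₃ x + 2 * (deriv γ₂ x * γ₁ s - deriv γ₁ x * γ₂ s)|
        = |2 * (deriv γ₁ x * e₂ - deriv γ₂ x * e₁)| := by
          rw [hhor x hxI]; congr 1; ring
      _ ≤ 2 * (|deriv γ₁ x| * |e₂| + |deriv γ₂ x| * |e₁|) := by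
          rw [abs_mul, abs_two, ← abs_mul, ← abs_mul]
          gcongr
          exact abs_sub _ _
      _ ≤ 2 * (D₁ * (M₂ * |t - s| ^ 2) + D₂ * (M₁ * |t - s| ^ 2)) := by
          gcongr
          · exact hB₁ x hxI
          · exact hB₂ x hxI
      _ = 2 * (D₁ * M₂ + D₂ * M₁) * |t - s| ^ 2 := by ring
  calc |γ₃ t - γ₃ s + 2 * (γ₂ t * γ₁ s - γ₁ t * γ₂ s)|
      = |(γ₃ t + 2 * (γ₂ t * γ₁ s - γ₁ t * γ₂ s))
          - (γ₃ s + 2 * (γ₂ s * γ₁ s - γ₁ s * γ₂ s))| := by congr 1; ring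
    _ ≤ 2 * (D₁ * M₂ + D₂ * M₁) * |t - s| ^ 2 * |t - s| := abs_sub_le_of_abs_deriv_le hderiv hbound
    _ = 2 * (D₁ * M₂ + D₂ * M₁) * |t - s| ^ 3 := by ring

/-- for a twice continuously differentiable horizontal curve,
`d_K(γ(t),γ(s))/|t-s| → √(γ̇¹(t)² + γ̇²(t)²)` as `s → t`, uniformly in `t ∈ [0,1]`. -/
theorem koranyi_metric_derivative (γ₁ γ₂ γ₃ : ℝ → ℝ)
    (h₁ : ContDiff ℝ 2 γ₁) (h₂ : ContDiff ℝ 2 γ₂) (h₃ : ContDiff ℝ 2 γ₃)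
    (hhor : ∀ t ∈ Ioo (0 : ℝ) 1,
      deriv γ₃ t = -2 * (γ₁ t * deriv γ₂ t - γ₂ t * deriv γ₁ t)) :
    ∀ ε > 0, ∃ δ > 0, ∀ s ∈ Icc (0 : ℝ) 1, ∀ t ∈ Icc (0 : ℝ) 1,
      0 < |t - s| → |t - s| < δ →
      |dK (mk3 (γ₁ t) (γ₂ t) (γ₃ t)) (mk3 (γ₁ s) (γ₂ s) (γ₃ s)) / |t - s|
          - Real.sqrt ((deriv γ₁ t) ^ 2 + (deriv γ₂ t) ^ 2)| < ε := by
  intro ε hε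
  have hhor' : ∀ t ∈ Icc (0 : ℝ) 1,
      deriv γ₃ t = -2 * (γ₁ t * deriv γ₂ t - γ₂ t * deriv γ₁ t) := by
    have hc₁ := h₁.continuous_deriv (by norm_num)
    have hc₂ := h₂.continuous_deriv (by norm_num)
    have hc₃ := h₃.continuous_deriv (by norm_num)
    have hγ₁ := h₁.continuous
    have hγ₂ := h₂.continuous
    have hEq : EqOn (deriv γ₃) (fun t ↦ -2 * (γ₁ t * deriv γ₂ t - γ₂ t * deriv γ₁ t))
        (Ioo (0 : ℝ) 1) := hhor
    have hcl := hEq.closure hc₃ (by fun_prop)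
    rwa [closure_Ioo zero_ne_one] at hcl
  obtain ⟨K, hK⟩ := exists_vertical_le h₁ h₂ (h₃.differentiable (by norm_num)) hhor'
  obtain ⟨M₁, -, hT₁⟩ := exists_taylor_remainder_le h₁ 0 1
  obtain ⟨M₂, -, hT₂⟩ := exists_taylor_remainder_le h₂ 0 1
  have hcont : Continuous fun h : ℝ ↦ √(K * |h|) + (M₁ * |h| + M₂ * |h|) := by fun_prop
  obtain ⟨δ, hδ, hsmall⟩ := Metric.continuous_iff.1 hcont 0 ε hε
  refine ⟨δ, hδ, fun s hs t ht hpos hlt ↦ ?_⟩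
  have hh : t - s ≠ 0 := abs_pos.1 hpos
  have hquot : ∀ {f : ℝ → ℝ} {M : ℝ}, |f t - f s - deriv f t * (t - s)| ≤ M * |t - s| ^ 2 →
      |(f t - f s) / (t - s) - deriv f t| ≤ M * |t - s| := by
    intro f M hf
    rw [div_sub' hh, abs_div, div_le_iff₀ hpos, mul_comm (t - s)]
    linarith
  rw [dK_mk3_div hh]
  set A := (γ₁ t - γ₁ s) / (t - s)
  set B := (γ₂ t - γ₂ s) / (t - s)
  set C := (γ₃ t - γ₃ s + 2 * (γ₂ t * γ₁ s - γ₁ t * γ₂ s)) / (t - s) ^ 2 with hCdef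
  have hC : |C| ≤ K * |t - s| := by
    rw [hCdef, abs_div, abs_pow, div_le_iff₀ (by positivity)]
    linarith [hK s hs t ht]
  calc _ ≤ |((A ^ 2 + B ^ 2) ^ 2 + C ^ 2) ^ ((1 : ℝ) / 4) - √(A ^ 2 + B ^ 2)|
        + |√(A ^ 2 + B ^ 2) - √(deriv γ₁ t ^ 2 + deriv γ₂ t ^ 2)| := abs_sub_le _ _ _
    _ ≤ √|C| + (|A - deriv γ₁ t| + |B - deriv γ₂ t|) :=
        add_le_add (abs_rpow_fourth_sub_sqrt_le (by positivity) C)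
          (abs_sqrt_sq_add_sq_sub_le _ _ _ _)
    _ ≤ √(K * |t - s|) + (M₁ * |t - s| + M₂ * |t - s|) :=
        add_le_add (Real.sqrt_le_sqrt hC)
          (add_le_add (hquot (hT₁ s hs t ht)) (hquot (hT₂ s hs t ht)))
    _ < ε := by
        have hdist := hsmall (t - s) (by simpa using hlt)
        simp only [abs_zero, mul_zero, Real.sqrt_zero, add_zero, Real.dist_eq, sub_zero] at hdist
        exact (le_abs_self _).trans_lt hdist
end

section
/- Let Λ > 0 and let p = (p₁,p₂,p₃), q = (q₁,q₂,q₃) ∈ ℝ³ satisfy max{|q₁|, |q₂|} ≤ Λ. Then d_K(p,q)⁴ ≤ (|p₁ - q₁|² + |p₂ - q₂|²)² + 2|p₃ - q₃|² + 8Λ²(|p₂ - q₂| + |p₁ - q₁|)². -/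
open Set Filter

/-- upper bound for the fourth power of the Korányi distance when the
horizontal coordinates of `q` are bounded by `Λ`. -/
theorem dK_pow_four_upper_bound (Λ : ℝ) (hΛ : 0 < Λ)
    (p q : EuclideanSpace ℝ (Fin 3)) (hq : max |q 0| |q 1| ≤ Λ) :
    dK p q ^ 4 ≤ (|p 0 - q 0| ^ 2 + |p 1 - q 1| ^ 2) ^ 2 + 2 * |p 2 - q 2| ^ 2
      + 8 * Λ ^ 2 * (|p 1 - q 1| + |p 0 - q 0|) ^ 2 := by
  have hy : |p 1 * q 0 - p 0 * q 1| ≤ Λ * (|p 1 - q 1| + |p 0 - q 0|) := by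
    calc |p 1 * q 0 - p 0 * q 1|
        = |(p 1 - q 1) * q 0 - (p 0 - q 0) * q 1| := by ring_nf
      _ ≤ |(p 1 - q 1) * q 0| + |(p 0 - q 0) * q 1| := abs_sub _ _
      _ = |q 0| * |p 1 - q 1| + |q 1| * |p 0 - q 0| := by simp only [abs_mul, mul_comm]
      _ ≤ Λ * |p 1 - q 1| + Λ * |p 0 - q 0| := by
        gcongr
        · exact (le_max_left _ _).trans hq
        · exact (le_max_right _ _).trans hq
      _ = Λ * (|p 1 - q 1| + |p 0 - q 0|) := by ring
  have hy_sq : (p 1 * q 0 - p 0 * q 1) ^ 2 ≤ Λ ^ 2 * (|p 1 - q 1| + |p 0 - q 0|) ^ 2 := by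
    rw [← mul_pow, ← sq_abs]
    gcongr
  have hdK : dK p q ^ 4 = (|p 0 - q 0| ^ 2 + |p 1 - q 1| ^ 2) ^ 2
      + |p 2 - q 2 + 2 * (p 1 * q 0 - p 0 * q 1)| ^ 2 := by
    rw [dK, ← Real.rpow_mul_natCast (by positivity)]
    norm_num
  rw [hdK, sq_abs (p 2 - q 2 + _), sq_abs (p 2 - q 2)]
  linarith [sq_nonneg (p 2 - q 2 - 2 * (p 1 * q 0 - p 0 * q 1))]
end
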